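/- arXiv:2312.03638 — 2 statements merged into one kernel-verified Lean document; each statement's English description precedes it below -/
import Mathlib

section
/- Let L = U^3 ⊕ E8^2 be the K3 lattice and define the involution I_enr by (v,u,u',e,e') ↦ (-v,u',u,e',e). Then the fixed sublattice L^{I_enr=1} is isomorphic to U(2) ⊕ E8(2), and the anti-fixed sublattice L^{I_enr=-1} is isomorphic to U ⊕ U(2) ⊕ E8(2). -/
noncomputable section

/-- The hyperbolic plane lattice `U`, as `ℤ²`. -/
abbrev ULat := Fin 2 → ℤ
/-- The (negative definite) `E8` lattice, as `ℤ⁸`. -/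
abbrev E8Lat := Fin 8 → ℤ

/-- Gram matrix of the hyperbolic plane `U`. -/
def Ugram : Matrix (Fin 2) (Fin 2) ℤ := !![0,1;1,0]

/-- Gram matrix of the negative definite `E8` lattice (negative of the E8 Cartan matrix,
in Bourbaki labeling). -/
def E8gram : Matrix (Fin 8) (Fin 8) ℤ :=
  !![-2,0,1,0,0,0,0,0;
     0,-2,0,1,0,0,0,0;
     1,0,-2,1,0,0,0,0;
     0,1,1,-2,1,0,0,0;
     0,0,0,1,-2,1,0,0;
     0,0,0,0,1,-2,1,0;
     0,0,0,0,0,1,-2,1;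
     0,0,0,0,0,0,1,-2]

/-- The bilinear form of `U`. -/
def Ubil : ULat →ₗ[ℤ] ULat →ₗ[ℤ] ℤ := Matrix.toLinearMap₂' ℤ Ugram
/-- The bilinear form of `E8`. -/
def E8bil : E8Lat →ₗ[ℤ] E8Lat →ₗ[ℤ] ℤ := Matrix.toLinearMap₂' ℤ E8gram

/-- Orthogonal direct sum of two bilinear forms. -/
def prodBil {M N : Type} [AddCommGroup M] [Module ℤ M] [AddCommGroup N] [Module ℤ N]
    (bM : M →ₗ[ℤ] M →ₗ[ℤ] ℤ) (bN : N →ₗ[ℤ] N →ₗ[ℤ] ℤ) :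
    (M × N) →ₗ[ℤ] (M × N) →ₗ[ℤ] ℤ :=
  LinearMap.mk₂ ℤ (fun x y => bM x.1 y.1 + bN x.2 y.2)
    (fun a b c => by simp [map_add]; ring)
    (fun r a b => by simp; ring)
    (fun a b c => by simp [map_add]; ring)
    (fun r a b => by simp; ring)

/-- Two (ℤ-)lattices with forms (valued in `R`) are isometric. -/
def IsometricForms {R M N : Type} [AddCommGroup M] [Module ℤ M] [AddCommGroup N] [Module ℤ N]
    (bM : M → M → R) (bN : N → N → R) : Prop :=
  ∃ e : M ≃ₗ[ℤ] N, ∀ x y, bN (e x) (e y) = bM x y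

/-- The K3 lattice `L = U ⊕ U ⊕ U ⊕ E8 ⊕ E8`. -/
abbrev K3Lat := ULat × ULat × ULat × E8Lat × E8Lat

/-- The bilinear form of the K3 lattice. -/
def K3bil : K3Lat →ₗ[ℤ] K3Lat →ₗ[ℤ] ℤ :=
  prodBil Ubil (prodBil Ubil (prodBil Ubil (prodBil E8bil E8bil)))

/-- The Enriques involution `(v,u,u',e,e') ↦ (-v,u',u,e',e)` on the K3 lattice. -/
def Ienr : K3Lat →ₗ[ℤ] K3Lat where
  toFun p := (-p.1, p.2.2.1, p.2.1, p.2.2.2.2, p.2.2.2.1)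
  map_add' a b := by simp [Prod.ext_iff, neg_add, add_comm]
  map_smul' c a := by simp [Prod.ext_iff]

/-- The fixed sublattice `L^{I=1}` of an involution. -/
def fixedLat {M : Type} [AddCommGroup M] [Module ℤ M] (f : M →ₗ[ℤ] M) : Submodule ℤ M :=
  LinearMap.ker (f - LinearMap.id)

/-- The anti-fixed sublattice `L^{I=-1}` of an involution. -/
def antifixedLat {M : Type} [AddCommGroup M] [Module ℤ M] (f : M →ₗ[ℤ] M) : Submodule ℤ M :=
  LinearMap.ker (f + LinearMap.id)

theorem prodBil_app {M N : Type} [AddCommGroup M] [Module ℤ M] [AddCommGroup N] [Module ℤ N]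
    (bM : M →ₗ[ℤ] M →ₗ[ℤ] ℤ) (bN : N →ₗ[ℤ] N →ₗ[ℤ] ℤ) (x y : M × N) :
    prodBil bM bN x y = bM x.1 y.1 + bN x.2 y.2 := rfl

theorem mem_fixed (p : K3Lat) : p ∈ fixedLat Ienr ↔
    p.1 = 0 ∧ p.2.2.1 = p.2.1 ∧ p.2.2.2.2 = p.2.2.2.1 := by
  have h : p ∈ fixedLat Ienr ↔ Ienr p = p := by
    simp [fixedLat, LinearMap.mem_ker, sub_eq_zero]
  rw [h]
  obtain ⟨v, u, u', e, e'⟩ := p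
  simp only [Ienr, LinearMap.coe_mk, AddHom.coe_mk, Prod.mk.injEq]
  constructor
  · rintro ⟨h1, h2, -, h3, -⟩
    exact ⟨self_eq_neg.mp h1.symm, h2, h3⟩
  · rintro ⟨rfl, rfl, rfl⟩
    simp

theorem mem_antifixed (p : K3Lat) : p ∈ antifixedLat Ienr ↔
    p.2.2.1 = -p.2.1 ∧ p.2.2.2.2 = -p.2.2.2.1 := by
  have h : p ∈ antifixedLat Ienr ↔ Ienr p = -p := by
    simp [antifixedLat, LinearMap.mem_ker, add_eq_zero_iff_eq_neg]
  rw [h]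
  obtain ⟨v, u, u', e, e'⟩ := p
  simp only [Ienr, LinearMap.coe_mk, AddHom.coe_mk, Prod.neg_mk, Prod.mk.injEq]
  constructor
  · rintro ⟨-, h2, -, h3, -⟩
    exact ⟨h2, h3⟩
  · rintro ⟨rfl, rfl⟩
    simp

def fixedEquiv : fixedLat Ienr ≃ₗ[ℤ] ULat × E8Lat where
  toFun p := (p.1.2.1, p.1.2.2.2.1)
  map_add' _ _ := rfl
  map_smul' _ _ := rfl
  invFun q := ⟨(0, q.1, q.1, q.2, q.2), (mem_fixed _).2 ⟨rfl, rfl, rfl⟩⟩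
  left_inv := by
    rintro ⟨⟨v, u, u', e, e'⟩, hp⟩
    obtain ⟨h1, h2, h3⟩ := (mem_fixed _).1 hp
    simp only at h1 h2 h3
    subst h1 h2 h3
    rfl
  right_inv _ := rfl

def antifixedEquiv : antifixedLat Ienr ≃ₗ[ℤ] ULat × ULat × E8Lat where
  toFun p := (p.1.1, p.1.2.1, p.1.2.2.2.1)
  map_add' _ _ := rfl
  map_smul' _ _ := rfl
  invFun q := ⟨(q.1, q.2.1, -q.2.1, q.2.2, -q.2.2), (mem_antifixed _).2 ⟨rfl, rfl⟩⟩
  left_inv := by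
    rintro ⟨⟨v, u, u', e, e'⟩, hp⟩
    obtain ⟨h2, h3⟩ := (mem_antifixed _).1 hp
    simp only at h2 h3
    subst h2 h3
    rfl
  right_inv _ := rfl

theorem stmt0 :
    IsometricForms (fun x y : fixedLat Ienr => K3bil x.1 y.1)
      (fun x y : ULat × E8Lat =>
        prodBil ((2:ℤ) • Ubil) ((2:ℤ) • E8bil) x y) ∧
    IsometricForms (fun x y : antifixedLat Ienr => K3bil x.1 y.1)
      (fun x y : ULat × ULat × E8Lat =>
        prodBil Ubil (prodBil ((2:ℤ) • Ubil) ((2:ℤ) • E8bil)) x y) := by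
  constructor
  · refine ⟨fixedEquiv, ?_⟩
    intro x y
    obtain ⟨h1, h2, h3⟩ := (mem_fixed _).1 x.2
    obtain ⟨k1, k2, k3⟩ := (mem_fixed _).1 y.2
    simp only [K3bil, prodBil_app, h1, h2, h3, k1, k2, k3, LinearMap.smul_apply, fixedEquiv,
      LinearEquiv.coe_mk, LinearMap.coe_mk, AddHom.coe_mk, map_zero, smul_eq_mul]
    ring
  · refine ⟨antifixedEquiv, ?_⟩
    intro x y
    obtain ⟨h2, h3⟩ := (mem_antifixed _).1 x.2
    obtain ⟨k2, k3⟩ := (mem_antifixed _).1 y.2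
    simp only [K3bil, prodBil_app, h2, h3, k2, k3, LinearMap.smul_apply, antifixedEquiv,
      LinearEquiv.coe_mk, LinearMap.coe_mk, AddHom.coe_mk, map_neg, LinearMap.neg_apply, neg_neg,
      smul_eq_mul]
    ring
end
end

section
/- Let T_dP = U ⊕ U(2) ⊕ E8 ⊕ E8 with involution I(v,u,e,e') = (v,u,-e',-e) (acting as identity on U ⊕ U(2) and swapping the two E8 factors with sign), so that the fixed sublattice is T_enr ≅ U ⊕ U(2) ⊕ E8(2) embedded as {(v,u,e,-e)}. Let α ∈ T_dP be a root with α·α = -2 and I(α) ≠ α, and set α_I = α + I(α). If α_I · α_I < 0, then α · I(α) = 0, α_I · α_I = -4, and α_I has divisibility 2 in T_enr (hence is a root of T_enr). -/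
noncomputable section

/-- The lattice `T_dP = U ⊕ U(2) ⊕ E8 ⊕ E8`. -/
abbrev TdPLat := ULat × ULat × E8Lat × E8Lat

/-- The bilinear form of `T_dP = U ⊕ U(2) ⊕ E8 ⊕ E8`. -/
def TdPbil : TdPLat →ₗ[ℤ] TdPLat →ₗ[ℤ] ℤ :=
  prodBil Ubil (prodBil ((2:ℤ) • Ubil) (prodBil E8bil E8bil))

/-- The involution `I(v,u,e,e') = (v,u,-e',-e)` on `T_dP`. -/
def ITdP : TdPLat →ₗ[ℤ] TdPLat where
  toFun p := (p.1, p.2.1, -p.2.2.2, -p.2.2.1)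
  map_add' a b := by simp [Prod.ext_iff, neg_add, add_comm]
  map_smul' c a := by simp [Prod.ext_iff]

/-- The fixed sublattice `T_enr = T_dP^{I=1} = {(v,u,e,-e)} ≅ U ⊕ U(2) ⊕ E8(2)`. -/
def TenrLat : Submodule ℤ TdPLat := LinearMap.ker (ITdP - LinearMap.id)

theorem E8bil_eq (x y : E8Lat) : E8bil x y =
    -2*(x 0*y 0+x 1*y 1+x 2*y 2+x 3*y 3+x 4*y 4+x 5*y 5+x 6*y 6+x 7*y 7)
    + (x 0*y 2+x 2*y 0+x 1*y 3+x 3*y 1+x 2*y 3+x 3*y 2+x 3*y 4+x 4*y 3+x 4*y 5+x 5*y 4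
      +x 5*y 6+x 6*y 5+x 6*y 7+x 7*y 6) := by
  simp only [E8bil, Matrix.toLinearMap₂'_apply, E8gram, Fin.sum_univ_eight]
  simp
  ring

theorem E8_comm (x y : E8Lat) : E8bil x y = E8bil y x := by
  rw [E8bil_eq, E8bil_eq]; ring

theorem E8_even (x : E8Lat) : ∃ k : ℤ, E8bil x x = 2 * k := by
  refine ⟨-(x 0*x 0+x 1*x 1+x 2*x 2+x 3*x 3+x 4*x 4+x 5*x 5+x 6*x 6+x 7*x 7)
    + (x 0*x 2+x 1*x 3+x 2*x 3+x 3*x 4+x 4*x 5+x 5*x 6+x 6*x 7), ?_⟩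
  rw [E8bil_eq]; ring

theorem E8_neg (x : E8Lat) (h : 0 ≤ E8bil x x) : x = 0 := by
  have key : 60 * E8bil x x = -(30*(2*x 1-x 3)^2+30*(2*x 0-x 2)^2+10*(3*x 2-2*x 3)^2
      +30*(2*x 7-x 6)^2+10*(3*x 6-2*x 5)^2+5*(4*x 5-3*x 4)^2+3*(5*x 4-4*x 3)^2+2*(x 3)^2) := by
    rw [E8bil_eq]; ring
  have p1 := sq_nonneg (2*x 1-x 3)
  have p2 := sq_nonneg (2*x 0-x 2)
  have p3 := sq_nonneg (3*x 2-2*x 3)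
  have p4 := sq_nonneg (2*x 7-x 6)
  have p5 := sq_nonneg (3*x 6-2*x 5)
  have p6 := sq_nonneg (4*x 5-3*x 4)
  have p7 := sq_nonneg (5*x 4-4*x 3)
  have p8 := sq_nonneg (x 3)
  have z1 : 2*x 1-x 3 = 0 := pow_eq_zero_iff two_ne_zero |>.1 (by linarith)
  have z2 : 2*x 0-x 2 = 0 := pow_eq_zero_iff two_ne_zero |>.1 (by linarith)
  have z3 : 3*x 2-2*x 3 = 0 := pow_eq_zero_iff two_ne_zero |>.1 (by linarith)
  have z4 : 2*x 7-x 6 = 0 := pow_eq_zero_iff two_ne_zero |>.1 (by linarith)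
  have z5 : 3*x 6-2*x 5 = 0 := pow_eq_zero_iff two_ne_zero |>.1 (by linarith)
  have z6 : 4*x 5-3*x 4 = 0 := pow_eq_zero_iff two_ne_zero |>.1 (by linarith)
  have z7 : 5*x 4-4*x 3 = 0 := pow_eq_zero_iff two_ne_zero |>.1 (by linarith)
  have z8 : x 3 = 0 := pow_eq_zero_iff two_ne_zero |>.1 (by linarith)
  funext i
  fin_cases i <;> simp <;> omega

set_option maxHeartbeats 2000000 in
theorem E8_odd (x : E8Lat) (h : E8bil x x = -2) : ∃ y : E8Lat, ¬ (2:ℤ) ∣ E8bil x y := by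
  by_contra! hc
  have h0 := hc (Pi.single 0 1)
  have h1 := hc (Pi.single 1 1)
  have h2 := hc (Pi.single 2 1)
  have h3 := hc (Pi.single 3 1)
  have h4 := hc (Pi.single 4 1)
  have h5 := hc (Pi.single 5 1)
  have h6 := hc (Pi.single 6 1)
  have h7 := hc (Pi.single 7 1)
  rw [E8bil_eq] at h0 h1 h2 h3 h4 h5 h6 h7
  simp [Pi.single_apply] at h0 h1 h2 h3 h4 h5 h6 h7
  have e0 : 2 ∣ x 0 := by omega
  have e1 : 2 ∣ x 1 := by omega
  have e2 : 2 ∣ x 2 := by omega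
  have e3 : 2 ∣ x 3 := by omega
  have e4 : 2 ∣ x 4 := by omega
  have e5 : 2 ∣ x 5 := by omega
  have e6 : 2 ∣ x 6 := by omega
  have e7 : 2 ∣ x 7 := by omega
  have hx : ∀ i, ∃ k, x i = 2 * k := by
    intro i
    fin_cases i <;> assumption
  choose z hz using hx
  have : x = (2:ℤ) • z := by funext i; simp [hz]
  rw [this] at h
  simp only [map_smul, LinearMap.smul_apply, smul_eq_mul] at h
  omega

theorem TdPbil_eq (a b : TdPLat) : TdPbil a b =
    Ubil a.1 b.1 + (2 * Ubil a.2.1 b.2.1 + (E8bil a.2.2.1 b.2.2.1 + E8bil a.2.2.2 b.2.2.2)) := by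
  simp [TdPbil, prodBil]

theorem ITdP_eq (v u : ULat) (e f : E8Lat) : ITdP (v, u, e, f) = (v, u, -f, -e) := rfl

theorem mem_Tenr (x : TdPLat) : x ∈ TenrLat ↔ ITdP x = x := by
  simp [TenrLat, sub_eq_zero]

/-- Folding a (-2)-root of `T_dP`: if `α·α = -2`, `I(α) ≠ α` and the folded vector
`α_I = α + I(α)` has negative square, then `α·I(α) = 0`, `α_I·α_I = -4`, `α_I` lies in
`T_enr`, and `α_I` has divisibility 2 in `T_enr` (hence is a root of `T_enr`). -/
theorem stmt6 (α : TdPLat) (h2 : TdPbil α α = -2) (hne : ITdP α ≠ α)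
    (hneg : TdPbil (α + ITdP α) (α + ITdP α) < 0) :
    TdPbil α (ITdP α) = 0 ∧
    TdPbil (α + ITdP α) (α + ITdP α) = -4 ∧
    (α + ITdP α) ∈ TenrLat ∧
    (∀ x ∈ TenrLat, (2:ℤ) ∣ TdPbil (α + ITdP α) x) ∧
    (∃ x ∈ TenrLat, TdPbil (α + ITdP α) x = 2) := by
  obtain ⟨v, u, e, f⟩ := α
  have hw : e + f ≠ 0 := by
    intro h
    apply hne
    have hf : f = -e := by rw [eq_neg_iff_add_eq_zero, add_comm]; exact h
    rw [ITdP_eq, hf, neg_neg]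
  have hw1 : E8bil (e+f) (e+f) < 0 := by
    by_contra! h
    exact hw (E8_neg _ h)
  obtain ⟨k, hk⟩ := E8_even (e+f)
  have hc := E8_comm f e
  have hk' := hk
  have hmem : ((v, u, e, f) + ITdP (v, u, e, f) : TdPLat) ∈ TenrLat := by
    rw [mem_Tenr, ITdP_eq]
    simp [ITdP, add_comm]
  simp only [map_add, LinearMap.add_apply] at hk
  have hneg' := hneg
  rw [TdPbil_eq] at h2
  rw [TdPbil_eq, ITdP_eq] at hneg'
  simp only [Prod.mk_add_mk, map_add, map_neg, LinearMap.add_apply, LinearMap.neg_apply]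
    at hneg' h2
  have hk1 : k = -1 := by omega
  subst hk1
  have hsq : TdPbil ((v, u, e, f) + ITdP (v, u, e, f)) ((v, u, e, f) + ITdP (v, u, e, f)) = -4 := by
    rw [TdPbil_eq, ITdP_eq]
    simp only [Prod.mk_add_mk, map_add, map_neg, LinearMap.add_apply, LinearMap.neg_apply]
    omega
  have hpair : ∀ x y z, TdPbil ((v, u, e, f) + ITdP (v, u, e, f)) (x, y, z, -z) =
      2 * (Ubil v x + 2 * Ubil u y + E8bil (e + f) z - 2 * E8bil f z) := by
    intro x y z
    rw [TdPbil_eq, ITdP_eq]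
    simp only [Prod.mk_add_mk, map_add, map_neg, LinearMap.add_apply, LinearMap.neg_apply]
    ring
  refine ⟨?_, hsq, hmem, ?_, ?_⟩
  · rw [TdPbil_eq, ITdP_eq]
    simp only [map_neg]
    omega
  · rintro ⟨x, y, z, w⟩ hx
    rw [mem_Tenr, ITdP_eq] at hx
    simp only [Prod.mk.injEq, true_and] at hx
    rw [← hx.2, hpair]
    exact dvd_mul_right _ _
  · obtain ⟨y, hy⟩ := E8_odd (e+f) (by omega)
    obtain ⟨m, hm⟩ : ∃ m, E8bil (e+f) y - 2 * E8bil f y = 2 * m + 1 :=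
      ⟨(E8bil (e+f) y - 2 * E8bil f y) / 2, by omega⟩
    refine ⟨((0, 0, y, -y) : TdPLat) + m • ((v, u, e, f) + ITdP (v, u, e, f)),
      TenrLat.add_mem ?_ (TenrLat.smul_mem _ hmem), ?_⟩
    · rw [mem_Tenr, ITdP_eq, neg_neg]
    · rw [map_add (TdPbil _), map_smul (TdPbil _), hsq, hpair]
      simp only [map_zero, smul_eq_mul]
      omega
end
end
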